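/- Let A be a complete finitely ambiguous NBW, fix an enumeration q_1, …, q_n of its states, and let w be an ω-word. Then w ∈ L(A) if and only if the reduced run DAG Ḡ of A over w has an accepting initial ω-branch. -/

import Mathlib

open scoped Classical

/-- A nondeterministic Büchi automaton on ω-words with states `Q` over alphabet `σ`. -/
structure NBW (σ : Type) (Q : Type) where
  init : Set Q
  trans : Q → σ → Set Q
  acc : Set Q

namespace NBW

variable {σ Q : Type}

/-- `ρ` is a run of `A` on the ω-word `w`. -/
def IsRun (A : NBW σ Q) (w : ℕ → σ) (ρ : ℕ → Q) : Prop :=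
  ρ 0 ∈ A.init ∧ ∀ i, ρ (i + 1) ∈ A.trans (ρ i) (w i)

/-- `ρ` is an accepting run of `A` on `w`: it visits `A.acc` infinitely often. -/
def IsAccRun (A : NBW σ Q) (w : ℕ → σ) (ρ : ℕ → Q) : Prop :=
  A.IsRun w ρ ∧ ∀ n, ∃ m, n ≤ m ∧ ρ m ∈ A.acc

/-- The ω-language accepted by `A`. -/
def Lang (A : NBW σ Q) : Set (ℕ → σ) := {w | ∃ ρ, A.IsAccRun w ρ}

/-- `A` is complete: every state has a successor on every letter. -/
def Complete (A : NBW σ Q) : Prop := ∀ q a, (A.trans q a).Nonempty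

/-- `A` is finitely ambiguous: every accepted word has finitely many accepting runs. -/
def FinitelyAmbiguous (A : NBW σ Q) : Prop :=
  ∀ w ∈ A.Lang, {ρ | A.IsAccRun w ρ}.Finite

/-- `A` is limit deterministic with partition `(QN, QD)`. -/
def LimitDetPart (A : NBW σ Q) (QN QD : Set Q) : Prop :=
  Disjoint QN QD ∧ QN ∪ QD = Set.univ ∧ A.acc ⊆ QD ∧
    ∀ q ∈ QD, ∀ a, ∃ q' ∈ QD, A.trans q a = {q'}

/-- `A` is limit deterministic (for some partition). -/
def LimitDet (A : NBW σ Q) : Prop := ∃ QN QD, A.LimitDetPart QN QD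

end NBW

namespace NBW

variable {σ Q : Type}

/-- The set of successors of the set `S` under letter `b`. -/
def dSet (A : NBW σ Q) (S : Set Q) (b : σ) : Set Q := ⋃ q ∈ S, A.trans q b

/-- The set of states occurring at level `ℓ` of the run DAG of `A` over `w`. -/
def levelSet (A : NBW σ Q) (w : ℕ → σ) : ℕ → Set Q
  | 0 => A.init
  | ℓ + 1 => A.dSet (levelSet A w ℓ) (w ℓ)

/-- Edge of the run DAG `G` of `A` over `w` from vertex `(q, ℓ)` to vertex `(q', ℓ+1)`. -/
def GEdge (A : NBW σ Q) (w : ℕ → σ) (q : Q) (ℓ : ℕ) (q' : Q) : Prop :=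
  q ∈ A.levelSet w ℓ ∧ q' ∈ A.trans q (w ℓ)

/-- Edge of the reduced run DAG `Ḡ` of `A` over `w` (wrt the fixed enumeration given
by the linear order on `Q`) from vertex `(q, ℓ)` to vertex `(q', ℓ+1)`:
`q` is the minimal state of level `ℓ` having `q'` as a successor. -/
def RedEdge (A : NBW σ Q) [LinearOrder Q] (w : ℕ → σ) (q : Q) (ℓ : ℕ) (q' : Q) : Prop :=
  q ∈ A.levelSet w ℓ ∧ q' ∈ A.trans q (w ℓ) ∧
    ∀ p ∈ A.levelSet w ℓ, q' ∈ A.trans p (w ℓ) → q ≤ p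

/-- `γ` is an initial ω-branch of the level-indexed DAG with edge relation `E`:
`γ ℓ` is the state of the branch vertex at level `ℓ`. -/
def IsInitOmegaBranch (A : NBW σ Q) (E : Q → ℕ → Q → Prop) (γ : ℕ → Q) : Prop :=
  γ 0 ∈ A.init ∧ ∀ ℓ, E (γ ℓ) ℓ (γ (ℓ + 1))

/-- The branch `γ` is accepting: it visits `F`-vertices infinitely often. -/
def IsAcceptingBranch (A : NBW σ Q) (γ : ℕ → Q) : Prop :=
  ∀ n, ∃ m, n ≤ m ∧ γ m ∈ A.acc

/-- There is an infinite branch from vertex `(q, ℓ)` inside the sub-DAG with vertex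
predicate `P` and edge relation `E`. -/
def SubInfBranch (P : Q → ℕ → Prop) (E : Q → ℕ → Q → Prop) (q : Q) (ℓ : ℕ) : Prop :=
  ∃ γ : ℕ → Q, γ 0 = q ∧ (∀ i, P (γ i) (ℓ + i)) ∧ ∀ i, E (γ i) (ℓ + i) (γ (i + 1))

/-- Vertex `(q', ℓ')` is reachable from vertex `(q, ℓ)` inside the sub-DAG with
vertex predicate `P` and edge relation `E`. -/
def SubReach (P : Q → ℕ → Prop) (E : Q → ℕ → Q → Prop)
    (q : Q) (ℓ : ℕ) (q' : Q) (ℓ' : ℕ) : Prop :=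
  ∃ n, ∃ γ : ℕ → Q, γ 0 = q ∧ γ n = q' ∧ ℓ' = ℓ + n ∧
    (∀ i ≤ n, P (γ i) (ℓ + i)) ∧ ∀ i < n, E (γ i) (ℓ + i) (γ (i + 1))

/-- Vertex `(q, ℓ)` is `F`-free in the sub-DAG with vertex predicate `P` and edge
relation `E`: it is not finite and no `F`-vertex is reachable from it. -/
def FFreeVtx (A : NBW σ Q) (P : Q → ℕ → Prop) (E : Q → ℕ → Q → Prop)
    (q : Q) (ℓ : ℕ) : Prop :=
  SubInfBranch P E q ℓ ∧ ∀ q' ℓ', SubReach P E q ℓ q' ℓ' → q' ∉ A.acc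

/-- The pruning sequence of the DAG with vertex predicate `P0` and edge relation `E`:
odd steps remove the finite vertices, even steps remove the `F`-free vertices,
everything being evaluated in the current graph. -/
def pruneSeq (A : NBW σ Q) (E : Q → ℕ → Q → Prop) (P0 : Q → ℕ → Prop) :
    ℕ → Q → ℕ → Prop
  | 0 => P0
  | i + 1 =>
    if i % 2 = 0 then
      fun q ℓ => pruneSeq A E P0 i q ℓ ∧ SubInfBranch (pruneSeq A E P0 i) E q ℓ
    else
      fun q ℓ => pruneSeq A E P0 i q ℓ ∧ ¬ A.FFreeVtx (pruneSeq A E P0 i) E q ℓ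

end NBW

theorem NBW.exists_red_prefix {σ Q : Type} [Fintype Q] [LinearOrder Q] (A : NBW σ Q)
    (w : ℕ → σ) : ∀ (l : ℕ) (q : Q), q ∈ A.levelSet w l →
      ∃ γ : ℕ → Q, γ 0 ∈ A.init ∧ γ l = q ∧ ∀ i < l, A.RedEdge w (γ i) i (γ (i + 1)) := by
  intro l
  induction l with
  | zero => exact fun q hq => ⟨fun _ => q, hq, rfl, fun i hi => absurd hi (Nat.not_lt_zero i)⟩
  | succ l ih =>
    intro q hq
    have hne : ({p | p ∈ A.levelSet w l ∧ q ∈ A.trans p (w l)} : Set Q).Nonempty := by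
      simp only [NBW.levelSet, NBW.dSet, Set.mem_iUnion] at hq
      obtain ⟨p, hp, hpq⟩ := hq
      exact ⟨p, hp, hpq⟩
    obtain ⟨p, ⟨hp, hpq⟩, hmin⟩ := Set.exists_min_image _ id (Set.toFinite _) hne
    obtain ⟨γ, h0, hl, hE⟩ := ih p hp
    refine ⟨fun i => if i ≤ l then γ i else q, by simpa using h0, by simp, ?_⟩
    intro i hi
    rcases Nat.lt_succ_iff_lt_or_eq.mp hi with h | h
    · have h1 : i ≤ l := h.le
      have h2 : i + 1 ≤ l := h
      simpa only [h1, h2, if_true] using hE i h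
    · subst h
      simp only [le_refl, if_true, Nat.not_succ_le_self, if_false, hl]
      exact ⟨hp, hpq, fun p' hp' hq' => hmin p' ⟨hp', hq'⟩⟩

theorem NBW.IsRun.mem_levelSet {σ Q : Type} {A : NBW σ Q}
    {w : ℕ → σ} {ρ : ℕ → Q} (h : A.IsRun w ρ) (l : ℕ) : ρ l ∈ A.levelSet w l := by
  induction l with
  | zero => exact h.1
  | succ l ih =>
    simp only [NBW.levelSet, NBW.dSet, Set.mem_iUnion]
    exact ⟨ρ l, ih, h.2 l⟩

/-- Acceptance via the reduced run DAG: for a complete FANBW `A`, a word `w` is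
accepted by `A` iff the reduced run DAG `Ḡ` of `A` over `w` has an accepting
initial ω-branch. -/
theorem NBW.reduced_dag_acceptance (σ Q : Type) [Fintype σ] [Nonempty σ]
    [Fintype Q] [LinearOrder Q] (A : NBW σ Q)
    (hc : A.Complete) (hfa : A.FinitelyAmbiguous) (w : ℕ → σ) :
    w ∈ A.Lang ↔
      ∃ γ : ℕ → Q, A.IsInitOmegaBranch (A.RedEdge w) γ ∧ A.IsAcceptingBranch γ := by
  constructor
  · rintro ⟨ρ, hρ⟩
    have hfin := hfa w ⟨ρ, hρ⟩
    have key : ∀ l ∈ {l | ∃ p ∈ A.levelSet w l, ρ (l + 1) ∈ A.trans p (w l) ∧ p ≠ ρ l},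
        ∃ r, A.IsAccRun w r ∧ r l ≠ ρ l ∧ ∀ k, l < k → r k = ρ k := by
      rintro l ⟨p, hp, hpt, hne⟩
      obtain ⟨γ, h0, hl, hE⟩ := A.exists_red_prefix w l p hp
      refine ⟨fun i => if i ≤ l then γ i else ρ i, ⟨⟨by simpa using h0, ?_⟩, ?_⟩, ?_, ?_⟩
      · intro i
        rcases lt_trichotomy i l with h | h | h
        · have h1 : i ≤ l := h.le
          have h2 : i + 1 ≤ l := h
          simpa only [h1, h2, if_true] using (hE i h).2.1
        · subst h
          simpa only [le_refl, if_true, Nat.not_succ_le_self, if_false, hl] using hpt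
        · have h1 : ¬ i ≤ l := by omega
          have h2 : ¬ i + 1 ≤ l := by omega
          simpa only [h1, h2, if_false] using hρ.1.2 i
      · intro n
        obtain ⟨m, hm, hm'⟩ := hρ.2 (max n (l + 1))
        have h1 : ¬ m ≤ l := by omega
        exact ⟨m, by omega, by simpa only [h1, if_false] using hm'⟩
      · simpa [hl] using hne
      · intro k hk
        simp [Nat.not_le.mpr hk]
    haveI : Nonempty (ℕ → Q) := ⟨ρ⟩
    choose! f hf1 hf2 hf3 using key
    have hB : {l | ∃ p ∈ A.levelSet w l, ρ (l + 1) ∈ A.trans p (w l) ∧ p ≠ ρ l}.Finite := by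
      refine Set.Finite.of_injOn (f := f) (fun l hl => hf1 l hl) ?_ hfin
      intro a ha b hb hab
      rcases lt_trichotomy a b with h | h | h
      · exact absurd (hab ▸ hf3 a ha b h) (hf2 b hb)
      · exact h
      · exact absurd (hab ▸ hf3 b hb a h) (hf2 a ha)
    obtain ⟨N, hN⟩ := hB.bddAbove
    obtain ⟨γ, h0, hl, hE⟩ := A.exists_red_prefix w (N + 1) (ρ (N + 1))
      (hρ.1.mem_levelSet (N + 1))
    refine ⟨fun i => if i < N + 1 then γ i else ρ i, ⟨by simpa using h0, ?_⟩, ?_⟩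
    · intro i
      by_cases h : i < N + 1
      · have h3 : (if i + 1 < N + 1 then γ (i + 1) else ρ (i + 1)) = γ (i + 1) := by
          split_ifs with h4
          · rfl
          · have : i = N := by omega
            subst this
            exact hl.symm
        simpa only [h3, h, if_true] using hE i h
      · have h2 : ¬ i + 1 < N + 1 := by omega
        simp only [h, h2, if_false]
        refine ⟨hρ.1.mem_levelSet i, hρ.1.2 i, fun p hp hpt => ?_⟩
        by_contra hcon
        have : i ≤ N := hN ⟨p, hp, hpt, fun e => hcon e.ge⟩
        omega
    · intro n
      obtain ⟨m, hm, hm'⟩ := hρ.2 (max n (N + 1))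
      have h1 : ¬ m < N + 1 := by omega
      exact ⟨m, by omega, by simpa only [h1, if_false] using hm'⟩
  · rintro ⟨γ, ⟨h0, hE⟩, hacc⟩
    exact ⟨γ, ⟨h0, fun i => (hE i).2.1⟩, hacc⟩
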